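/- (Existence Lemma) Let Δ0 be an MCS containing K_x y = T_y, K_y x = T_x, x ≡ c_x, y ≡ c_y, and let M^{Δ0} be the induced canonical model. For any z ∈ {x,y}, any Δ ∈ Σ of M^{Δ0}, and any α ∈ L_B, if K_z α ∉ Δ, then there is some Δ' ∈ Σ such that Δ ∼_z Δ' and α ∉ Δ'. -/

import Mathlib

/-! Core definitions for the Epistemic Logic of Cops and Robbers (ELCR). -/

/-- The two players/variables. -/
inductive Var : Type
  | x | y
  deriving DecidableEq

/-- The other variable. -/
def Var.other : Var → Var
  | .x => .y
  | .y => .x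

/-- Terms: constants or variables. -/
inductive Term (Cons : Type) : Type
  | const (c : Cons)
  | var (v : Var)
  deriving DecidableEq

/-- Formulas of the full language `L` (with movement modalities). -/
inductive Form (Pred Cons : Type) : Type
  | pred (P : Pred) (args : List (Term Cons))
  | rel (t₁ t₂ : Term Cons)
  | eq (t₁ t₂ : Term Cons)
  | neg (φ : Form Pred Cons)
  | and (φ ψ : Form Pred Cons)
  | Kt (z : Var) (t : Term Cons)
  | K (z : Var) (φ : Form Pred Cons)
  | box (z : Var) (φ : Form Pred Cons)

namespace Form

variable {Pred Cons : Type}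

def imp (φ ψ : Form Pred Cons) : Form Pred Cons := .neg (.and φ (.neg ψ))
def or (φ ψ : Form Pred Cons) : Form Pred Cons := .neg (.and (.neg φ) (.neg ψ))
def iffF (φ ψ : Form Pred Cons) : Form Pred Cons := .and (imp φ ψ) (imp ψ φ)
def falseF : Form Pred Cons := .neg (.eq (.var .x) (.var .x))
def trueF : Form Pred Cons := .neg falseF
/-- `⟨K_z⟩φ := ¬K_z¬φ`. -/
def diaK (z : Var) (φ : Form Pred Cons) : Form Pred Cons := .neg (.K z (.neg φ))

def bigAnd : List (Form Pred Cons) → Form Pred Cons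
  | [] => trueF
  | φ :: l => .and φ (bigAnd l)

def bigOr : List (Form Pred Cons) → Form Pred Cons
  | [] => falseF
  | φ :: l => or φ (bigOr l)

/-- Membership in the Boolean base language `L_B`. -/
def isBase : Form Pred Cons → Prop
  | .pred _ _ => True
  | .rel _ _ => True
  | .eq _ _ => True
  | .neg φ => isBase φ
  | .and φ ψ => isBase φ ∧ isBase ψ
  | .Kt _ _ => False
  | .K _ _ => False
  | .box _ _ => False

/-- Membership in `L_BD` (Booleans plus movement modalities). -/
def isBD : Form Pred Cons → Prop
  | .pred _ _ => True
  | .rel _ _ => True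
  | .eq _ _ => True
  | .neg φ => isBD φ
  | .and φ ψ => isBD φ ∧ isBD ψ
  | .Kt _ _ => False
  | .K _ _ => False
  | .box _ φ => isBD φ

/-- Membership in the full language `L`. -/
def isL : Form Pred Cons → Prop
  | .pred _ _ => True
  | .rel _ _ => True
  | .eq _ _ => True
  | .neg φ => isL φ
  | .and φ ψ => isL φ ∧ isL ψ
  | .Kt _ _ => True
  | .K _ ψ => isBD ψ
  | .box _ φ => isL φ

/-- Membership in the static fragment `L⁻`: no movement modalities, and the
knowledge operator `K_z` is applied to `L_B`-formulas only. -/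
def isStatic : Form Pred Cons → Prop
  | .pred _ _ => True
  | .rel _ _ => True
  | .eq _ _ => True
  | .neg φ => isStatic φ
  | .and φ ψ => isStatic φ ∧ isStatic ψ
  | .Kt _ _ => True
  | .K _ φ => isBase φ
  | .box _ _ => False

/-- The variable `z` occurs in the formula. -/
def occurs (z : Var) : Form Pred Cons → Prop
  | .pred _ args => Term.var z ∈ args
  | .rel t₁ t₂ => t₁ = Term.var z ∨ t₂ = Term.var z
  | .eq t₁ t₂ => t₁ = Term.var z ∨ t₂ = Term.var z
  | .neg φ => occurs z φ
  | .and φ ψ => occurs z φ ∨ occurs z ψ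
  | .Kt w t => w = z ∨ t = Term.var z
  | .K w φ => w = z ∨ occurs z φ
  | .box w φ => w = z ∨ occurs z φ

/-- The list of terms occurring in a formula. -/
def termList : Form Pred Cons → List (Term Cons)
  | .pred _ args => args
  | .rel t₁ t₂ => [t₁, t₂]
  | .eq t₁ t₂ => [t₁, t₂]
  | .neg φ => termList φ
  | .and φ ψ => termList φ ++ termList ψ
  | .Kt _ t => [t]
  | .K _ φ => termList φ
  | .box _ φ => termList φ

end Form

/-- Substituting the constant `c` for the variable `z` in a term. -/
def Term.substC {Cons : Type} (c : Cons) (z : Var) : Term Cons → Term Cons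
  | .var v => if v = z then .const c else .var v
  | .const c' => .const c'

/-- `φ.substC c z` is `φ[c/z]`. -/
def Form.substC {Pred Cons : Type} (c : Cons) (z : Var) : Form Pred Cons → Form Pred Cons
  | .pred P args => .pred P (args.map (Term.substC c z))
  | .rel t₁ t₂ => .rel (t₁.substC c z) (t₂.substC c z)
  | .eq t₁ t₂ => .eq (t₁.substC c z) (t₂.substC c z)
  | .neg φ => .neg (φ.substC c z)
  | .and φ ψ => .and (φ.substC c z) (ψ.substC c z)
  | .Kt w t => .Kt w (t.substC c z)
  | .K w φ => .K w (φ.substC c z)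
  | .box w φ => .box w (φ.substC c z)

/-- Replacing the term `t₂` by the term `t₁`. -/
def Term.repl {Cons : Type} [DecidableEq Cons] (t₁ t₂ t : Term Cons) : Term Cons :=
  if t = t₂ then t₁ else t

/-- `φ.replace t₁ t₂` is `φ[t₁/t₂]`: the result of replacing `t₂` in `φ` with `t₁`. -/
def Form.replace {Pred Cons : Type} [DecidableEq Cons] (t₁ t₂ : Term Cons) :
    Form Pred Cons → Form Pred Cons
  | .pred P args => .pred P (args.map (Term.repl t₁ t₂))
  | .rel s₁ s₂ => .rel (Term.repl t₁ t₂ s₁) (Term.repl t₁ t₂ s₂)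
  | .eq s₁ s₂ => .eq (Term.repl t₁ t₂ s₁) (Term.repl t₁ t₂ s₂)
  | .neg φ => .neg (φ.replace t₁ t₂)
  | .and φ ψ => .and (φ.replace t₁ t₂) (ψ.replace t₁ t₂)
  | .Kt w t => .Kt w (Term.repl t₁ t₂ t)
  | .K w φ => .K w (φ.replace t₁ t₂)
  | .box w φ => .box w (φ.replace t₁ t₂)

/-- The list of all terms (constants and variables), for finite `Cons`. -/
noncomputable def allTerms (Cons : Type) [Fintype Cons] : List (Term Cons) :=
  (Finset.univ : Finset Cons).toList.map Term.const ++ [Term.var .x, Term.var .y]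

/-- The syntactic distance formulas `D^n t₁ t₂`. -/
noncomputable def distForm (Pred : Type) {Cons : Type} [Fintype Cons] :
    ℕ → Term Cons → Term Cons → Form Pred Cons
  | 0, t₁, t₂ => .eq t₁ t₂
  | n + 1, t₁, t₂ =>
      Form.or (distForm Pred n t₁ t₂)
        (Form.bigOr ((allTerms Cons).map fun t =>
          Form.and (distForm Pred n t₁ t) (Form.or (.rel t t₂) (.rel t₂ t))))

/-- `K_z z' = T`: the set `T` consists of the possible positions of `z'` considered by `z`. -/
noncomputable def KzEqSet {Pred Cons : Type} [Fintype Cons] [DecidableEq Cons]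
    (z z' : Var) (T : Finset Cons) : Form Pred Cons :=
  Form.bigAnd
    ((T.toList.map fun c => Form.diaK z (.eq (.var z') (.const c))) ++
      (Tᶜ.toList.map fun c => Form.K z (.neg (.eq (.var z') (.const c)))))

/-- `Rz = T`: `T` is exactly the set of (names of) R-successors of `z`. -/
noncomputable def RzEqSet {Pred Cons : Type} [Fintype Cons] [DecidableEq Cons]
    (z : Var) (T : Finset Cons) : Form Pred Cons :=
  Form.bigAnd
    ((T.toList.map fun c => Form.rel (.var z) (.const c)) ++
      (Tᶜ.toList.map fun c => Form.neg (Form.rel (.var z) (.const c))))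

/-- The list of all subsets of `Cons`. -/
noncomputable def powList (Cons : Type) [Fintype Cons] [DecidableEq Cons] : List (Finset Cons) :=
  (Finset.univ : Finset Cons).powerset.toList

/-! ### Semantics -/

/-- An interpretation of the vocabulary over a domain `D`. -/
structure Interp (Pred Cons D : Type) where
  pred : Pred → List D → Prop
  rel : D → D → Prop
  const : Cons → D

/-- Assignments (situations): positions of the two players. -/
abbrev Assign (D : Type) := Var → D

/-- The value of a term at an interpretation and a situation. -/
def Term.val {Pred Cons D : Type} (I : Interp Pred Cons D) (σ : Assign D) :
    Term Cons → D
  | .const c => I.const c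
  | .var v => σ v

/-- `Dball I m s` is `D^m(s)`: points reachable from `s` in at most `m` steps
along `I.rel` or its converse. -/
def Dball {Pred Cons D : Type} (I : Interp Pred Cons D) : ℕ → D → Set D
  | 0, s => {s}
  | m + 1, s => Dball I m s ∪ {t | ∃ u ∈ Dball I m s, I.rel u t ∨ I.rel t u}

/-- `R^z σ σ'`: player `z` moves along an arrow, the other player stays put. -/
def Rstep {Pred Cons D : Type} (I : Interp Pred Cons D) (z : Var) (σ σ' : Assign D) : Prop :=
  I.rel (σ z) (σ' z) ∧ σ z.other = σ' z.other

/-- Indistinguishability data: a relation on assignments for each player. -/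
abbrev SimRel (D : Type) := Var → Assign D → Assign D → Prop

/-- `Σ|σ`: the situations related to `σ` by some player's indistinguishability. -/
def restrict {D : Type} (Sit : Set (Assign D)) (sim : SimRel D) (σ : Assign D) :
    Set (Assign D) :=
  {σ' ∈ Sit | ∃ z, sim z σ σ'}

/-- The updated set of situations after player `z` moves from `σ₁` to `σ₂`. -/
def updSit {Pred Cons D : Type} (k : ℕ) (I : Interp Pred Cons D)
    (Sit : Set (Assign D)) (sim : SimRel D) (z : Var) (σ₁ σ₂ : Assign D) :
    Set (Assign D) :=
  {σ' | (σ₂ Var.x ∈ Dball I k (σ₂ Var.y) ∧ σ' = σ₂) ∨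
        (σ₂ Var.x ∉ Dball I k (σ₂ Var.y) ∧
          (∃ σ ∈ restrict Sit sim σ₁, Rstep I z σ σ') ∧
          σ' Var.x ∉ Dball I k (σ' Var.y))}

/-- The updated indistinguishability relations: `σ₁ ∼'_z σ₂` iff `σ₁ z = σ₂ z`. -/
def updSim (D : Type) : SimRel D := fun z σ₁ σ₂ => σ₁ z = σ₂ z

/-- Satisfaction for `ELCR` (with sight `k`). -/
def Sat {Pred Cons D : Type} (k : ℕ) (I : Interp Pred Cons D) :
    Set (Assign D) → SimRel D → Assign D → Form Pred Cons → Prop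
  | _, _, σ, .pred P args => I.pred P (args.map (Term.val I σ))
  | _, _, σ, .rel t₁ t₂ => I.rel (t₁.val I σ) (t₂.val I σ)
  | _, _, σ, .eq t₁ t₂ => t₁.val I σ = t₂.val I σ
  | Sit, sim, σ, .neg φ => ¬ Sat k I Sit sim σ φ
  | Sit, sim, σ, .and φ ψ => Sat k I Sit sim σ φ ∧ Sat k I Sit sim σ ψ
  | Sit, sim, σ, .Kt z t => ∀ σ' ∈ Sit, sim z σ' σ → t.val I σ = t.val I σ'
  | Sit, sim, σ, .K z φ => ∀ σ' ∈ Sit, sim z σ' σ → Sat k I Sit sim σ' φ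
  | Sit, sim, σ, .box z φ => ∀ σ₂, Rstep I z σ σ₂ →
      Sat k I (updSit k I Sit sim z σ σ₂) (updSim D) σ₂ φ

/-- The conditions making `(D, I, Σ, ∼)` a model: seriality of `I.rel`, every
point named by a constant, `Σ` nonempty, and each `∼_z` an equivalence relation on `Σ`. -/
structure IsModel {Pred Cons D : Type} (I : Interp Pred Cons D)
    (Sit : Set (Assign D)) (sim : SimRel D) : Prop where
  serial : ∀ s, ∃ t, I.rel s t
  const_surj : Function.Surjective I.const
  nonempty : Sit.Nonempty
  sim_mem : ∀ z σ σ', sim z σ σ' → σ ∈ Sit ∧ σ' ∈ Sit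
  sim_refl : ∀ z, ∀ σ ∈ Sit, sim z σ σ
  sim_symm : ∀ z σ σ', sim z σ σ' → sim z σ' σ
  sim_trans : ∀ z σ₁ σ₂ σ₃, sim z σ₁ σ₂ → sim z σ₂ σ₃ → sim z σ₁ σ₃

/-- The `k`-sight condition. -/
def KSight {Pred Cons D : Type} (k : ℕ) (I : Interp Pred Cons D)
    (Sit : Set (Assign D)) (sim : SimRel D) : Prop :=
  ∀ z σ σ', σ ∈ Sit → σ' ∈ Sit → sim z σ σ' →
    ∀ z', σ z' ∈ Dball I k (σ z) → σ z' = σ' z'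

/-- A nonempty conjunction `K_zα₁ ∧ ⋯ ∧ K_zαₙ ∧ ⟨K_z⟩β₁ ∧ ⋯ ∧ ⟨K_z⟩βₘ`. -/
def kConj {Pred Cons : Type} (z : Var) (αs βs : List (Form Pred Cons)) :
    Form Pred Cons :=
  Form.bigAnd (αs.map (Form.K z) ++ βs.map (Form.diaK z))
/-! ### The proof system ELCR⁻ -/

/-- Evaluation of a formula under a propositional valuation of its non-Boolean
components: used to define propositional tautologies. -/
def Form.evalProp {Pred Cons : Type} (v : Form Pred Cons → Prop) :
    Form Pred Cons → Prop
  | .neg φ => ¬ Form.evalProp v φ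
  | .and φ ψ => Form.evalProp v φ ∧ Form.evalProp v ψ
  | φ => v φ

/-- Propositional tautologies. -/
def Form.Tautology {Pred Cons : Type} (φ : Form Pred Cons) : Prop :=
  ∀ v : Form Pred Cons → Prop, Form.evalProp v φ

/-- The Hilbert-style proof system `ELCR⁻` for the static fragment, with sight `k`. -/
inductive Prov {Pred Cons : Type} [Fintype Cons] [DecidableEq Cons] (k : ℕ) :
    Form Pred Cons → Prop
  | taut {φ : Form Pred Cons} : φ.isStatic → φ.Tautology → Prov k φ
  | mp {φ ψ : Form Pred Cons} : Prov k (φ.imp ψ) → Prov k φ → Prov k ψ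
  | eqRefl (t : Term Cons) : Prov k (.eq t t)
  | eqSymm (t₁ t₂ : Term Cons) : Prov k ((Form.eq t₁ t₂).imp (.eq t₂ t₁))
  | eqTrans (t₁ t₂ t₃ : Term Cons) :
      Prov k (((Form.eq t₁ t₂).and (.eq t₂ t₃)).imp (.eq t₁ t₃))
  | eqSubst {α : Form Pred Cons} (t₁ t₂ : Term Cons) : α.isBase →
      Prov k ((Form.eq t₁ t₂).imp (α.iffF (α.replace t₁ t₂)))
  | seriality (c : Cons) :
      Prov k (Form.bigOr ((Finset.univ : Finset Cons).toList.map fun t =>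
        Form.rel (.const c) (.const t)))
  | atSomewhere (z : Var) :
      Prov k (Form.bigOr ((Finset.univ : Finset Cons).toList.map fun c =>
        Form.eq (.var z) (.const c)))
  | ksight (z : Var) (t : Term Cons) :
      Prov k ((distForm Pred k (.var z) t).imp (.Kt z t))
  | kAx {α β : Form Pred Cons} (z : Var) : α.isBase → β.isBase →
      Prov k ((Form.K z (α.imp β)).imp ((Form.K z α).imp (.K z β)))
  | tAx {α : Form Pred Cons} (z : Var) : α.isBase →
      Prov k ((Form.K z α).imp α)
  | kGround {α : Form Pred Cons} (z : Var) (T : Finset Cons) : α.isBase →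
      Prov k ((KzEqSet z z.other T).imp
        ((Form.K z α).iffF (Form.bigAnd (T.toList.map fun c => α.substC c z.other))))
  | kAdd {α : Form Pred Cons} (z : Var) (αs βs : List (Form Pred Cons)) :
      α.isBase → (∀ γ ∈ αs, γ.isBase) → (∀ γ ∈ βs, γ.isBase) →
      1 ≤ αs.length + βs.length →
      Prov k ((kConj z αs βs).imp α) → Prov k ((kConj z αs βs).imp (.K z α))
  | kElim {α β : Form Pred Cons} (z : Var) (αs βs : List (Form Pred Cons)) :
      α.isBase → β.isBase → (∀ γ ∈ αs, γ.isBase) → (∀ γ ∈ βs, γ.isBase) →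
      1 ≤ αs.length + βs.length →
      Prov k ((kConj z.other αs βs).imp ((Form.K z α).imp β)) →
      Prov k ((kConj z.other αs βs).imp (α.imp β))
  | deRe (z : Var) (t : Term Cons) (c : Cons) :
      Prov k ((Form.eq t (.const c)).imp
        ((Form.Kt z t).iffF (.K z (.eq t (.const c)))))
  | structK {α : Form Pred Cons} (z : Var) (T : Finset (Term Cons)) : α.isBase →
      (∀ t ∈ α.termList, t ∈ T) →
      Prov k (((Form.bigAnd (T.toList.map (Form.Kt z))).and α).imp (.K z α))

/-- A set of formulas is consistent if no finite conjunction from it proves `⊥`. -/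
def consistentS {Pred Cons : Type} [Fintype Cons] [DecidableEq Cons] (k : ℕ)
    (Γ : Set (Form Pred Cons)) : Prop :=
  ¬ ∃ l : List (Form Pred Cons), (∀ φ ∈ l, φ ∈ Γ) ∧
      Prov k ((Form.bigAnd l).imp Form.falseF)

/-- Maximally consistent sets of `L⁻`-formulas. -/
def MCS {Pred Cons : Type} [Fintype Cons] [DecidableEq Cons] (k : ℕ)
    (Δ : Set (Form Pred Cons)) : Prop :=
  consistentS k Δ ∧ (∀ φ ∈ Δ, Form.isStatic φ) ∧
    ∀ φ : Form Pred Cons, φ.isStatic → φ ∈ Δ ∨ Form.neg φ ∈ Δ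

/-- All terms of the formula are constants. -/
def isConsOnly {Pred Cons : Type} (φ : Form Pred Cons) : Prop :=
  ∀ t ∈ φ.termList, ∃ c : Cons, t = Term.const c

/-- `Δ₁ =^Cons Δ₂`: the two sets contain the same `L_B`-formulas whose terms are
all constants. -/
def consEq {Pred Cons : Type} (Δ₁ Δ₂ : Set (Form Pred Cons)) : Prop :=
  ∀ α : Form Pred Cons, α.isBase → isConsOnly α → (α ∈ Δ₁ ↔ α ∈ Δ₂)
/-! ### The canonical model -/

/-- The equivalence class of the constant `c` determined by `Δ₀`. -/
def eqClass {Pred Cons : Type} (Δ₀ : Set (Form Pred Cons)) (c : Cons) : Set Cons :=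
  {c' | Form.eq (Term.const c') (Term.const c) ∈ Δ₀}

/-- The canonical domain: equivalence classes of constants. -/
def CanD {Pred Cons : Type} (Δ₀ : Set (Form Pred Cons)) : Type :=
  {S : Set Cons // ∃ c, S = eqClass Δ₀ c}

/-- `[c]`, as an element of the canonical domain. -/
def canConst {Pred Cons : Type} (Δ₀ : Set (Form Pred Cons)) (c : Cons) : CanD Δ₀ :=
  ⟨eqClass Δ₀ c, c, rfl⟩

/-- The canonical interpretation. -/
def canI {Pred Cons : Type} (Δ₀ : Set (Form Pred Cons)) : Interp Pred Cons (CanD Δ₀) where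
  pred P ds := ∃ cs : List Cons, ds = cs.map (canConst Δ₀) ∧
    Form.pred P (cs.map Term.const) ∈ Δ₀
  rel d₁ d₂ := ∃ c₁ c₂, d₁ = canConst Δ₀ c₁ ∧ d₂ = canConst Δ₀ c₂ ∧
    Form.rel (Term.const c₁) (Term.const c₂) ∈ Δ₀
  const := canConst Δ₀

/-- `K_z Δ := {α : K_z α ∈ Δ}`. -/
def Kset {Pred Cons : Type} (z : Var) (Δ : Set (Form Pred Cons)) : Set (Form Pred Cons) :=
  {α | Form.K z α ∈ Δ}

/-- The canonical set of situations, as a collection of MCSs. -/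
def CanSit {Pred Cons : Type} [Fintype Cons] [DecidableEq Cons] (k : ℕ)
    (Δ₀ : Set (Form Pred Cons)) (Ty Tx : Finset Cons) (cx cy : Cons) :
    Set (Set (Form Pred Cons)) :=
  {Δ₀} ∪
  {Δ | MCS k Δ ∧ consEq Δ Δ₀ ∧ KzEqSet Var.x Var.y Ty ∈ Δ ∧
      Form.K Var.y (Form.eq (.var .x) (.const cx)) ∈ Δ ∧
      ∃ c ∈ Ty, Form.eq (.var .y) (.const c) ∈ Δ ∧
        Form.neg (Form.eq (.const c) (.const cy)) ∈ Δ} ∪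
  {Δ | MCS k Δ ∧ consEq Δ Δ₀ ∧ KzEqSet Var.y Var.x Tx ∈ Δ ∧
      Form.K Var.x (Form.eq (.var .y) (.const cy)) ∈ Δ ∧
      ∃ c ∈ Tx, Form.eq (.var .x) (.const c) ∈ Δ ∧
        Form.neg (Form.eq (.const c) (.const cx)) ∈ Δ}

/-- The assignment induced by an MCS `Δ`: `Δ(z) = [c]` whenever `z ≡ c ∈ Δ`. -/
noncomputable def canAsg {Pred Cons : Type} [Nonempty Cons]
    (Δ₀ Δ : Set (Form Pred Cons)) : Assign (CanD Δ₀) := fun z =>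
  canConst Δ₀ (open Classical in
    if h : ∃ c : Cons, Form.eq (Term.var z) (Term.const c) ∈ Δ then h.choose
    else Classical.arbitrary Cons)

/-- The canonical set of situations, as a set of assignments. -/
noncomputable def CanSitA {Pred Cons : Type} [Fintype Cons] [DecidableEq Cons] [Nonempty Cons]
    (k : ℕ) (Δ₀ : Set (Form Pred Cons)) (Ty Tx : Finset Cons) (cx cy : Cons) :
    Set (Assign (CanD Δ₀)) :=
  canAsg Δ₀ '' CanSit k Δ₀ Ty Tx cx cy

/-- The canonical indistinguishability relations: `Δ₁ ∼_z Δ₂` iff `K_z Δ₁ = K_z Δ₂`. -/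
def canSim {Pred Cons : Type} [Nonempty Cons] (Δ₀ : Set (Form Pred Cons))
    (S : Set (Set (Form Pred Cons))) : SimRel (CanD Δ₀) := fun z σ₁ σ₂ =>
  ∃ Δ₁ ∈ S, ∃ Δ₂ ∈ S, σ₁ = canAsg Δ₀ Δ₁ ∧ σ₂ = canAsg Δ₀ Δ₂ ∧ Kset z Δ₁ = Kset z Δ₂
namespace Form

variable {Pred Cons : Type}

theorem isBase.isStatic : ∀ {φ : Form Pred Cons}, φ.isBase → φ.isStatic
  | .pred _ _, _ => trivial
  | .rel _ _, _ => trivial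
  | .eq _ _, _ => trivial
  | .neg φ, h => isBase.isStatic (φ := φ) h
  | .and _ _, h => ⟨isBase.isStatic h.1, isBase.isStatic h.2⟩

theorem isBase.substC (c : Cons) (z : Var) :
    ∀ {φ : Form Pred Cons}, φ.isBase → (φ.substC c z).isBase
  | .pred _ _, _ => trivial
  | .rel _ _, _ => trivial
  | .eq _ _, _ => trivial
  | .neg φ, h => isBase.substC c z (φ := φ) h
  | .and _ _, h => ⟨isBase.substC c z h.1, isBase.substC c z h.2⟩

theorem bigAnd_isStatic {l : List (Form Pred Cons)} (h : ∀ φ ∈ l, φ.isStatic) :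
    (bigAnd l).isStatic := by
  induction l with
  | nil => trivial
  | cons φ l ih =>
    exact ⟨h _ (by simp), ih fun ψ hψ => h ψ (by simp [hψ])⟩

theorem bigOr_isStatic {l : List (Form Pred Cons)} (h : ∀ φ ∈ l, φ.isStatic) :
    (bigOr l).isStatic := by
  induction l with
  | nil => trivial
  | cons φ l ih =>
    exact ⟨h φ (by simp), ih fun ψ hψ => h ψ (by simp [hψ])⟩

section evalProp

variable (v : Form Pred Cons → Prop) (φ ψ : Form Pred Cons)

theorem evalProp_neg : evalProp v φ.neg ↔ ¬ evalProp v φ := Iff.rfl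

theorem evalProp_and : evalProp v (φ.and ψ) ↔ evalProp v φ ∧ evalProp v ψ := Iff.rfl

theorem evalProp_imp : evalProp v (φ.imp ψ) ↔ (evalProp v φ → evalProp v ψ) := by
  simp [imp, evalProp]

theorem evalProp_or : evalProp v (φ.or ψ) ↔ evalProp v φ ∨ evalProp v ψ := by
  simp only [or, evalProp]; tauto

theorem evalProp_falseF :
    evalProp v falseF ↔ ¬ evalProp v (.eq (.var .x) (.var .x)) := Iff.rfl

theorem evalProp_bigAnd (l : List (Form Pred Cons)) :
    evalProp v (bigAnd l) ↔
      evalProp v (.eq (.var .x) (.var .x)) ∧ ∀ φ ∈ l, evalProp v φ := by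
  induction l with
  | nil => simp [bigAnd, trueF, evalProp_neg, evalProp_falseF]
  | cons φ l ih => simp only [bigAnd, evalProp_and, ih, List.forall_mem_cons]; tauto

end evalProp

theorem substC_eq_replace [DecidableEq Cons] (c : Cons) (z : Var) (φ : Form Pred Cons) :
    φ.substC c z = φ.replace (.const c) (.var z) := by
  have hT : Term.substC c z = Term.repl (.const c) (.var z) := by
    funext t; cases t <;> simp [Term.substC, Term.repl]
  induction φ <;> simp_all [Form.substC, Form.replace]

theorem termList_substC (c : Cons) (z : Var) (φ : Form Pred Cons) :
    (φ.substC c z).termList = φ.termList.map (Term.substC c z) := by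
  induction φ <;> simp_all [Form.substC, termList]

theorem substC_substC_isConsOnly (z : Var) (c d : Cons) (φ : Form Pred Cons) :
    isConsOnly ((φ.substC c z.other).substC d z) := by
  intro t ht
  simp only [termList_substC, List.map_map, List.mem_map, Function.comp] at ht
  obtain ⟨s, -, rfl⟩ := ht
  rcases s with a | v
  · exact ⟨a, rfl⟩
  · cases z <;> cases v <;> simp [Term.substC, Var.other]

end Form

open Form in
theorem distForm_isStatic {Pred Cons : Type} [Fintype Cons] (n : ℕ) (s t : Term Cons) :
    (distForm Pred n s t).isStatic := by
  induction n generalizing t with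
  | zero => trivial
  | succ n ih =>
    refine ⟨ih t, bigOr_isStatic fun φ hφ => ?_⟩
    obtain ⟨u, -, rfl⟩ := List.mem_map.1 hφ
    exact ⟨ih u, trivial, trivial⟩

section Derivability

variable {Pred Cons : Type} [Fintype Cons] [DecidableEq Cons] {k : ℕ}

open Form

/-- Provable formulas are closed under propositional entailment. -/
theorem Prov.of_entails {φ : Form Pred Cons} (l : List (Form Pred Cons))
    (hl : ∀ ψ ∈ l, Prov k ψ ∧ ψ.isStatic) (hφ : φ.isStatic)
    (h : ∀ v, (∀ ψ ∈ l, evalProp v ψ) → evalProp v φ) : Prov k φ := by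
  induction l generalizing φ with
  | nil => exact .taut hφ fun v => h v (by simp)
  | cons ψ l ih =>
    refine .mp (ih (fun χ hχ => hl χ (by simp [hχ])) ⟨(hl ψ (by simp)).2, hφ⟩ ?_)
      (hl ψ (by simp)).1
    intro v hv
    rw [evalProp_imp]
    exact fun hψ => h v (by simpa using ⟨hψ, hv⟩)

theorem Prov.necessitation {α : Form Pred Cons} (z : Var) (hα : α.isBase)
    (h : Prov k α) : Prov k (.K z α) := by
  have hs := hα.isStatic
  have h₁ : Prov k ((kConj z [α.neg] []).imp (.K z α)) := by
    refine .kAdd z _ _ hα (List.forall_mem_singleton.2 hα) (by simp) (by simp) ?_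
    refine .of_entails [α] (by simpa using ⟨h, hs⟩) ⟨⟨hα, trivial⟩, hs⟩ fun v hv => ?_
    rw [evalProp_imp]
    exact fun _ => hv α (by simp)
  have h₂ : Prov k ((kConj z [] [α]).imp (.K z α)) := by
    refine .kAdd z _ _ hα (by simp) (by simpa using hα) (by simp) ?_
    refine .of_entails [α] (by simpa using ⟨h, hs⟩) ⟨⟨hα, trivial⟩, hs⟩ fun v hv => ?_
    rw [evalProp_imp]
    exact fun _ => hv α (by simp)
  refine .of_entails [_, _, _]
    (List.forall_mem_cons.2 ⟨⟨h₁, ⟨⟨hα, trivial⟩, hα⟩⟩, List.forall_mem_cons.2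
      ⟨⟨h₂, ⟨⟨hα, trivial⟩, hα⟩⟩, List.forall_mem_cons.2
      ⟨⟨.eqRefl (.var .x), trivial⟩, by simp⟩⟩⟩) hα fun v hv => ?_
  simp only [List.forall_mem_cons, evalProp_imp, kConj, evalProp_bigAnd, List.map_cons,
    List.map_nil, List.append_nil, List.nil_append, diaK, evalProp_neg] at hv
  simp only [List.not_mem_nil, false_imp_iff, implies_true, and_true] at hv
  tauto

theorem prov_distForm_self (n : ℕ) (t : Term Cons) : Prov k (distForm Pred n t t) := by
  induction n with
  | zero => exact .eqRefl t
  | succ n ih =>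
    refine .of_entails [distForm Pred n t t] (by simpa using ⟨ih, distForm_isStatic n t t⟩)
      (distForm_isStatic (n + 1) t t) fun v hv => ?_
    rw [distForm, evalProp_or]
    exact .inl (hv _ (by simp))

theorem consistentS.exists_prov_neg_of_insert {Γ : Set (Form Pred Cons)}
    {φ : Form Pred Cons} (hΓ : ∀ ψ ∈ Γ, ψ.isStatic) (hφ : φ.isStatic)
    (h : ¬ consistentS k (insert φ Γ)) :
    ∃ l : List (Form Pred Cons), (∀ ψ ∈ l, ψ ∈ Γ) ∧ Prov k ((bigAnd l).imp φ.neg) := by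
  classical
  obtain ⟨l, hl, hp⟩ := not_not.1 h
  have hls : ∀ ψ ∈ l, ψ.isStatic := fun ψ hψ => by
    rcases hl ψ hψ with rfl | h'
    exacts [hφ, hΓ ψ h']
  have hm : ∀ ψ ∈ l.filter (· ≠ φ), ψ ∈ Γ := fun ψ hψ => by
    simp only [List.mem_filter, decide_eq_true_eq] at hψ
    exact (hl ψ hψ.1).resolve_left hψ.2
  refine ⟨_, hm, .of_entails [_] (List.forall_mem_singleton.2
    ⟨hp, bigAnd_isStatic hls, trivial⟩) ⟨bigAnd_isStatic fun ψ hψ => hΓ ψ (hm ψ hψ), hφ⟩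
    fun v hv => ?_⟩
  rw [List.forall_mem_singleton, evalProp_imp, evalProp_bigAnd, evalProp_falseF] at hv
  rw [evalProp_imp, evalProp_bigAnd, evalProp_neg]
  rintro ⟨h₀, h₁⟩ h₂
  refine hv ⟨h₀, fun ψ hψ => ?_⟩ h₀
  by_cases hψφ : ψ = φ
  · exact hψφ ▸ h₂
  · exact h₁ ψ (by simpa using ⟨hψ, hψφ⟩)

/-- Lindenbaum's lemma. -/
theorem consistentS.exists_mcs {Γ : Set (Form Pred Cons)} (hΓ : consistentS k Γ)
    (hs : ∀ φ ∈ Γ, φ.isStatic) : ∃ Δ, Γ ⊆ Δ ∧ MCS k Δ := by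
  obtain ⟨Δ, hΓΔ, hmax⟩ := zorn_subset_nonempty
    {Δ : Set (Form Pred Cons) | consistentS k Δ ∧ ∀ φ ∈ Δ, φ.isStatic} (by
      rintro C hC hchain ⟨Θ₀, hΘ₀⟩
      refine ⟨⋃₀ C, ⟨?_, ?_⟩, fun Θ hΘ => Set.subset_sUnion_of_mem hΘ⟩
      · rintro ⟨l, hl, hp⟩
        have : ∃ Θ ∈ C, ∀ φ ∈ l, φ ∈ Θ := by
          clear hp
          induction l with
          | nil => exact ⟨Θ₀, hΘ₀, by simp⟩
          | cons φ l ih =>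
            obtain ⟨Θ, hΘ, hlΘ⟩ := ih fun ψ hψ => hl ψ (by simp [hψ])
            obtain ⟨Θ', hΘ', hφ⟩ := hl φ (by simp)
            rcases hchain.total hΘ hΘ' with hle | hle
            · exact ⟨Θ', hΘ', List.forall_mem_cons.2 ⟨hφ, fun ψ hψ => hle (hlΘ ψ hψ)⟩⟩
            · exact ⟨Θ, hΘ, List.forall_mem_cons.2 ⟨hle hφ, hlΘ⟩⟩
        obtain ⟨Θ, hΘ, hlΘ⟩ := this
        exact (hC hΘ).1 ⟨l, hlΘ, hp⟩
      · rintro φ ⟨Θ, hΘ, hφ⟩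
        exact (hC hΘ).2 φ hφ) Γ ⟨hΓ, hs⟩
  refine ⟨Δ, hΓΔ, hmax.prop.1, hmax.prop.2, fun φ hφ => ?_⟩
  by_contra! hcon
  have key : ∀ ψ : Form Pred Cons, ψ.isStatic → ψ ∉ Δ → ¬ consistentS k (insert ψ Δ) := by
    intro ψ hψ hψΔ hc
    refine hψΔ (hmax.le_of_ge (y := insert ψ Δ) ⟨hc, ?_⟩ (Set.subset_insert ψ Δ)
      (Set.mem_insert ψ Δ))
    rintro χ (rfl | hχ)
    exacts [hψ, hmax.prop.2 χ hχ]
  obtain ⟨l₁, hl₁, hp₁⟩ :=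
    consistentS.exists_prov_neg_of_insert hmax.prop.2 hφ (key φ hφ hcon.1)
  obtain ⟨l₂, hl₂, hp₂⟩ :=
    consistentS.exists_prov_neg_of_insert hmax.prop.2 (φ := φ.neg) hφ (key φ.neg hφ hcon.2)
  have hs₁ := bigAnd_isStatic fun ψ hψ => hmax.prop.2 ψ (hl₁ ψ hψ)
  have hs₂ := bigAnd_isStatic fun ψ hψ => hmax.prop.2 ψ (hl₂ ψ hψ)
  have hl : ∀ ψ ∈ l₁ ++ l₂, ψ ∈ Δ := fun ψ hψ =>
    (List.mem_append.1 hψ).elim (hl₁ ψ) (hl₂ ψ)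
  refine hmax.prop.1 ⟨l₁ ++ l₂, hl, .of_entails [_, _]
    (List.forall_mem_cons.2 ⟨⟨hp₁, hs₁, hφ⟩, List.forall_mem_singleton.2 ⟨hp₂, hs₂, hφ⟩⟩)
    ⟨bigAnd_isStatic fun ψ hψ => hmax.prop.2 ψ (hl ψ hψ), trivial⟩ fun v hv => ?_⟩
  rw [List.forall_mem_cons, List.forall_mem_singleton] at hv
  simp only [evalProp_imp, evalProp_bigAnd, evalProp_neg] at hv
  simp only [evalProp_imp, evalProp_bigAnd, List.forall_mem_append]
  tauto

end Derivability

section Seed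

variable {Pred Cons : Type} {Δ : Set (Form Pred Cons)} {β : Form Pred Cons}

open Form

/-- The knowledge and diamond formulas of player `z` in `Δ`, together with the knowledge of
the other player that `z` is at `d`, and a base formula `β`. -/
def seed (z : Var) (Δ : Set (Form Pred Cons)) (d : Cons) (β : Form Pred Cons) :
    Set (Form Pred Cons) :=
  {φ | φ ∈ Δ ∧ ∃ γ, γ.isBase ∧ φ = .K z γ} ∪ {φ | φ ∈ Δ ∧ ∃ γ, γ.isBase ∧ φ = diaK z γ} ∪
    {.K z.other (.eq (.var z) (.const d)), β}

theorem seed_isStatic {z : Var} {d : Cons} (hβ : β.isBase) :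
    ∀ φ ∈ seed z Δ d β, φ.isStatic := by
  rintro φ ((⟨-, γ, hγ, rfl⟩ | ⟨-, γ, hγ, rfl⟩) | (rfl | rfl))
  exacts [hγ, hγ, trivial, hβ.isStatic]

theorem kConj_isStatic {z : Var} {αs βs : List (Form Pred Cons)}
    (h₁ : ∀ γ ∈ αs, γ.isBase) (h₂ : ∀ γ ∈ βs, γ.isBase) : (kConj z αs βs).isStatic := by
  refine bigAnd_isStatic fun φ hφ => ?_
  rcases List.mem_append.1 hφ with h | h <;> obtain ⟨γ, hγ, rfl⟩ := List.mem_map.1 h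
  exacts [h₁ γ hγ, h₂ γ hγ]

end Seed

namespace MCS

variable {Pred Cons : Type} [Fintype Cons] [DecidableEq Cons] {k : ℕ}
  {Δ Δ₀ : Set (Form Pred Cons)} {φ ψ α β : Form Pred Cons}

open Form

theorem mem_of_prov_of_entails (hΔ : MCS k Δ) (l l' : List (Form Pred Cons))
    (hl : ∀ χ ∈ l, χ ∈ Δ) (hl' : ∀ χ ∈ l', Prov k χ ∧ χ.isStatic) (hφ : φ.isStatic)
    (h : ∀ v, (∀ χ ∈ l, evalProp v χ) → (∀ χ ∈ l', evalProp v χ) → evalProp v φ) :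
    φ ∈ Δ := by
  refine (hΔ.2.2 φ hφ).resolve_right fun hn => hΔ.1 ⟨φ.neg :: l, ?_, ?_⟩
  · exact List.forall_mem_cons.2 ⟨hn, hl⟩
  · refine .of_entails l' hl' ⟨⟨hφ, bigAnd_isStatic fun ψ hψ => hΔ.2.1 ψ (hl ψ hψ)⟩, trivial⟩
      fun v hv => ?_
    rw [evalProp_imp, evalProp_bigAnd, List.forall_mem_cons, evalProp_neg]
    exact fun hc => (hc.2.1 (h v hc.2.2 hv)).elim

theorem mem_of_prov (hΔ : MCS k Δ) (h : Prov k φ) (hφ : φ.isStatic) : φ ∈ Δ :=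
  hΔ.mem_of_prov_of_entails [] [φ] (by simp) (by simpa using ⟨h, hφ⟩) hφ
    fun _ _ hv => hv φ (by simp)

theorem mem_of_entails (hΔ : MCS k Δ) (l : List (Form Pred Cons))
    (hl : ∀ χ ∈ l, χ ∈ Δ) (hφ : φ.isStatic)
    (h : ∀ v, (∀ χ ∈ l, evalProp v χ) → evalProp v φ) : φ ∈ Δ :=
  hΔ.mem_of_prov_of_entails l [] hl (by simp) hφ fun v hv _ => h v hv

theorem mem_of_prov_imp (hΔ : MCS k Δ) (h : Prov k (φ.imp ψ)) (hφ : φ ∈ Δ)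
    (hψ : ψ.isStatic) : ψ ∈ Δ := by
  refine hΔ.mem_of_prov_of_entails [φ] [φ.imp ψ] (by simpa using hφ)
    (List.forall_mem_singleton.2 ⟨h, hΔ.2.1 φ hφ, hψ⟩) hψ fun v hv hv' => ?_
  rw [List.forall_mem_singleton] at hv hv'
  exact (evalProp_imp v φ ψ).1 hv' hv

theorem mem_of_imp (hΔ : MCS k Δ) (h : φ.imp ψ ∈ Δ) (hφ : φ ∈ Δ) : ψ ∈ Δ := by
  refine hΔ.mem_of_entails [φ, φ.imp ψ] (by simpa using ⟨hφ, h⟩) (hΔ.2.1 _ h).2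
    fun v hv => ?_
  rw [List.forall_mem_cons, List.forall_mem_singleton, evalProp_imp] at hv
  exact hv.2 hv.1

theorem neg_mem_iff (hΔ : MCS k Δ) (hφ : φ.isStatic) : φ.neg ∈ Δ ↔ φ ∉ Δ := by
  refine ⟨fun hn hp => hΔ.1 ⟨[φ, φ.neg], by simpa using ⟨hp, hn⟩, ?_⟩,
    fun h => (hΔ.2.2 φ hφ).resolve_left h⟩
  refine .taut ⟨⟨hφ, hφ, trivial⟩, trivial⟩ fun v => ?_
  rw [evalProp_imp, evalProp_bigAnd, List.forall_mem_cons, List.forall_mem_singleton,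
    evalProp_neg]
  tauto

theorem and_mem_iff (hΔ : MCS k Δ) : φ.and ψ ∈ Δ ↔ φ ∈ Δ ∧ ψ ∈ Δ := by
  refine ⟨fun h => ⟨?_, ?_⟩, fun h => ?_⟩
  · exact hΔ.mem_of_entails [φ.and ψ] (by simpa using h) (hΔ.2.1 _ h).1
      fun v hv => (hv (φ.and ψ) (by simp)).1
  · exact hΔ.mem_of_entails [φ.and ψ] (by simpa using h) (hΔ.2.1 _ h).2
      fun v hv => (hv (φ.and ψ) (by simp)).2
  · exact hΔ.mem_of_entails [φ, ψ] (by simpa using h) ⟨hΔ.2.1 _ h.1, hΔ.2.1 _ h.2⟩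
      fun v hv => ⟨hv _ (by simp), hv _ (by simp)⟩

theorem mem_iff_of_iffF_mem (hΔ : MCS k Δ) (h : φ.iffF ψ ∈ Δ) : φ ∈ Δ ↔ ψ ∈ Δ :=
  have h' := hΔ.and_mem_iff.1 h
  ⟨hΔ.mem_of_imp h'.1, hΔ.mem_of_imp h'.2⟩

theorem bigAnd_mem_iff (hΔ : MCS k Δ) {l : List (Form Pred Cons)} :
    bigAnd l ∈ Δ ↔ ∀ φ ∈ l, φ ∈ Δ := by
  induction l with
  | nil =>
    simp only [bigAnd, List.not_mem_nil, false_imp_iff, implies_true, iff_true]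
    refine hΔ.mem_of_prov_of_entails [] [.eq (.var .x) (.var .x)] (by simp)
      (by simpa using ⟨.eqRefl _, trivial⟩) trivial fun v _ hv => ?_
    exact not_not.2 (hv _ (by simp))
  | cons φ l ih => rw [bigAnd, hΔ.and_mem_iff, ih, List.forall_mem_cons]

theorem K_mem_mono (hΔ : MCS k Δ) {z : Var} (hα : α.isBase) (hβ : β.isBase)
    (h : Prov k (α.imp β)) (hK : .K z α ∈ Δ) : .K z β ∈ Δ :=
  hΔ.mem_of_imp
    (hΔ.mem_of_prov_imp (.kAx z hα hβ)
      (hΔ.mem_of_prov (.necessitation z ⟨hα, hβ⟩ h) ⟨hα, hβ⟩) ⟨hα, hβ⟩) hK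

theorem substC_mem_iff (hΔ : MCS k Δ) {w : Var} {c : Cons} (hα : α.isBase)
    (h : .eq (.var w) (.const c) ∈ Δ) : α.substC c w ∈ Δ ↔ α ∈ Δ := by
  have hs := (hα.substC c w).isStatic
  have h' := hΔ.mem_of_prov_imp (.eqSymm _ _) h trivial
  rw [substC_eq_replace] at hs ⊢
  exact (hΔ.mem_iff_of_iffF_mem (hΔ.mem_of_prov_imp (.eqSubst _ _ hα) h'
    ⟨⟨hα.isStatic, hs⟩, hs, hα.isStatic⟩)).symm

theorem K_mem_iff (hΔ : MCS k Δ) {z : Var} {T : Finset Cons}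
    (hT : KzEqSet z z.other T ∈ Δ) (hα : α.isBase) :
    .K z α ∈ Δ ↔ ∀ c ∈ T, α.substC c z.other ∈ Δ := by
  have hs : (bigAnd (T.toList.map fun c => α.substC c z.other)).isStatic :=
    bigAnd_isStatic fun φ hφ => by
      obtain ⟨c, -, rfl⟩ := List.mem_map.1 hφ
      exact (hα.substC c _).isStatic
  rw [hΔ.mem_iff_of_iffF_mem (hΔ.mem_of_prov_imp (.kGround z T hα) hT
    ⟨⟨hα, hs⟩, hs, hα⟩), hΔ.bigAnd_mem_iff]
  simp

theorem Kset_eq (hΔ : MCS k Δ) (hΔ₀ : MCS k Δ₀) (hc : consEq Δ Δ₀) {z : Var}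
    {T : Finset Cons} {d : Cons} (hT : KzEqSet z z.other T ∈ Δ)
    (hT₀ : KzEqSet z z.other T ∈ Δ₀) (hd : .eq (.var z) (.const d) ∈ Δ)
    (hd₀ : .eq (.var z) (.const d) ∈ Δ₀) : Kset z Δ = Kset z Δ₀ := by
  have key : ∀ α : Form Pred Cons, α.isBase → (.K z α ∈ Δ ↔ .K z α ∈ Δ₀) := by
    intro α hα
    rw [hΔ.K_mem_iff hT hα, hΔ₀.K_mem_iff hT₀ hα]
    refine forall₂_congr fun c _ => ?_
    have hb := hα.substC c z.other
    rw [← hΔ.substC_mem_iff hb hd, ← hΔ₀.substC_mem_iff hb hd₀]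
    exact hc _ (hb.substC d z) (substC_substC_isConsOnly z c d α)
  ext α
  exact ⟨fun h => (key α (hΔ.2.1 _ h)).1 h, fun h => (key α (hΔ₀.2.1 _ h)).2 h⟩

theorem Kt_const_mem (hΔ : MCS k Δ) (z : Var) (c : Cons) : .Kt z (.const c) ∈ Δ := by
  refine (hΔ.mem_iff_of_iffF_mem (hΔ.mem_of_prov_imp (.deRe z (.const c) c)
    (hΔ.mem_of_prov (.eqRefl _) trivial) ⟨⟨trivial, trivial⟩, trivial, trivial⟩)).2 ?_
  exact hΔ.mem_of_prov (.necessitation z trivial (.eqRefl _)) trivial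

theorem Kt_self_mem (hΔ : MCS k Δ) (z : Var) : .Kt z (.var z) ∈ Δ :=
  hΔ.mem_of_prov_imp (.ksight z (.var z))
    (hΔ.mem_of_prov (prov_distForm_self k _) (distForm_isStatic k _ _)) trivial

theorem K_mem_of_Kt_mem (hΔ : MCS k Δ) {z : Var} (hα : α.isBase)
    (ht : ∀ t ∈ α.termList, .Kt z t ∈ Δ) (h : α ∈ Δ) : .K z α ∈ Δ := by
  refine hΔ.mem_of_prov_imp (.structK z α.termList.toFinset hα (by simp))
    (hΔ.and_mem_iff.2 ⟨hΔ.bigAnd_mem_iff.2 ?_, h⟩) hα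
  simpa using ht

theorem K_mem_of_isConsOnly (hΔ : MCS k Δ) {z : Var} (hα : α.isBase)
    (hc : isConsOnly α) (h : α ∈ Δ) : .K z α ∈ Δ := by
  refine hΔ.K_mem_of_Kt_mem hα (fun t ht => ?_) h
  obtain ⟨c, rfl⟩ := hc t ht
  exact hΔ.Kt_const_mem z c

/-- A player who knows the position of the opponent knows every true base formula. -/
theorem K_mem_of_K_eq_mem (hΔ : MCS k Δ) {z : Var} {d : Cons}
    (hd : .K z (.eq (.var z.other) (.const d)) ∈ Δ) (hα : α.isBase) (h : α ∈ Δ) :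
    .K z α ∈ Δ := by
  have hother : .Kt z (.var z.other) ∈ Δ :=
    (hΔ.mem_iff_of_iffF_mem (hΔ.mem_of_prov_imp (.deRe z (.var z.other) d)
      (hΔ.mem_of_prov_imp (.tAx z trivial) hd trivial)
      ⟨⟨trivial, trivial⟩, trivial, trivial⟩)).2 hd
  refine hΔ.K_mem_of_Kt_mem hα (fun t _ => ?_) h
  rcases t with c | v
  · exact hΔ.Kt_const_mem z c
  · have hz := hΔ.Kt_self_mem z
    cases z <;> cases v <;> assumption

theorem consEq_of_Kset_eq (hΔ : MCS k Δ) (hΔ₀ : MCS k Δ₀) {z : Var}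
    (h : Kset z Δ = Kset z Δ₀) : consEq Δ Δ₀ := by
  intro α hα hc
  have hK : .K z α ∈ Δ ↔ .K z α ∈ Δ₀ := Set.ext_iff.1 h α
  exact ⟨fun hm => hΔ₀.mem_of_prov_imp (.tAx z hα)
      (hK.1 (hΔ.K_mem_of_isConsOnly hα hc hm)) hα.isStatic,
    fun hm => hΔ.mem_of_prov_imp (.tAx z hα)
      (hK.2 (hΔ₀.K_mem_of_isConsOnly hα hc hm)) hα.isStatic⟩

theorem exists_kConj (hΔ : MCS k Δ) (z : Var) (d : Cons) (l : List (Form Pred Cons))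
    (hl : ∀ φ ∈ l, φ ∈ seed z Δ d β) :
    ∃ αs βs : List (Form Pred Cons), (∀ γ ∈ αs, γ.isBase) ∧ (∀ γ ∈ βs, γ.isBase) ∧
      1 ≤ αs.length + βs.length ∧ kConj z αs βs ∈ Δ ∧
      ∀ φ ∈ l, φ ∈ αs.map (Form.K z) ++ βs.map (Form.diaK z) ∨
        φ = .K z.other (.eq (.var z) (.const d)) ∨ φ = β := by
  simp only [kConj, hΔ.bigAnd_mem_iff]
  induction l with
  | nil =>
    refine ⟨[.eq (.var z) (.var z)], [], by simp [isBase], by simp, by simp, ?_, by simp⟩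
    simpa using hΔ.mem_of_prov
      (.necessitation z (α := .eq (.var z) (.var z)) trivial (.eqRefl _)) trivial
  | cons φ l ih =>
    obtain ⟨αs, βs, h₁, h₂, h₃, h₄, h₅⟩ := ih fun ψ hψ => hl ψ (by simp [hψ])
    rcases hl φ (by simp) with (⟨hφ, γ, hγ, rfl⟩ | ⟨hφ, γ, hγ, rfl⟩) | hφ
    · refine ⟨γ :: αs, βs, List.forall_mem_cons.2 ⟨hγ, h₁⟩, h₂, by simp; omega, ?_, ?_⟩
      · exact List.forall_mem_cons.2 ⟨hφ, h₄⟩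
      · refine List.forall_mem_cons.2 ⟨.inl (by simp), fun ψ hψ => (h₅ ψ hψ).imp_left ?_⟩
        exact List.mem_cons_of_mem _
    · refine ⟨αs, γ :: βs, h₁, List.forall_mem_cons.2 ⟨hγ, h₂⟩, by simp; omega, ?_, ?_⟩
      · intro ψ hψ
        rcases List.mem_append.1 hψ with hψ | hψ
        · exact h₄ ψ (List.mem_append_left _ hψ)
        · rcases List.mem_cons.1 hψ with rfl | hψ
          · exact hφ
          · exact h₄ ψ (List.mem_append_right _ hψ)
      · refine List.forall_mem_cons.2 ⟨.inl (by simp), fun ψ hψ => (h₅ ψ hψ).imp_left ?_⟩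
        intro h
        rcases List.mem_append.1 h with h | h
        · exact List.mem_append_left _ h
        · exact List.mem_append_right _ (List.mem_cons_of_mem _ h)
    · exact ⟨αs, βs, h₁, h₂, h₃, h₄, List.forall_mem_cons.2 ⟨.inr hφ, h₅⟩⟩

theorem seed_consistentS (hΔ : MCS k Δ) {z : Var} {d : Cons} (hβ : β.isBase)
    (h : .K z ((Form.eq (.var z) (.const d)).imp β.neg) ∉ Δ) :
    consistentS k (seed z Δ d β) := by
  rintro ⟨l, hl, hp⟩
  obtain ⟨αs, βs, h₁, h₂, h₃, h₄, h₅⟩ := hΔ.exists_kConj z d l hl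
  have hs := kConj_isStatic (z := z) h₁ h₂
  have hz : z.other.other = z := by cases z <;> rfl
  have hp' : Prov k ((kConj z.other.other αs βs).imp
      ((Form.K z.other (.eq (.var z) (.const d))).imp β.neg)) := by
    rw [hz]
    refine .of_entails [_] (List.forall_mem_singleton.2
      ⟨hp, bigAnd_isStatic fun φ hφ => seed_isStatic hβ φ (hl φ hφ), trivial⟩)
      ⟨hs, trivial, hβ.isStatic⟩ fun v hv => ?_
    simp only [List.forall_mem_singleton, evalProp_imp, evalProp_bigAnd,
      evalProp_falseF] at hv
    simp only [kConj, evalProp_imp, evalProp_bigAnd, evalProp_neg]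
    rintro ⟨h₆, h₇⟩ h₈ h₉
    refine hv ⟨h₆, fun φ hφ => ?_⟩ h₆
    rcases h₅ φ hφ with h | rfl | rfl
    exacts [h₇ φ h, h₈, h₉]
  have hp'' := Prov.kElim (α := .eq (.var z) (.const d)) (β := β.neg) z.other αs βs trivial hβ h₁ h₂ h₃ hp'
  rw [hz] at hp''
  exact h (hΔ.mem_of_prov_imp (.kAdd z αs βs ⟨trivial, hβ⟩ h₁ h₂ h₃ hp'') h₄
    ⟨trivial, hβ⟩)

theorem Kset_eq_of_seed_subset (hΔ : MCS k Δ) {Δ' : Set (Form Pred Cons)}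
    (hΔ' : MCS k Δ') {z : Var} {d : Cons} (h : seed z Δ d β ⊆ Δ') :
    Kset z Δ = Kset z Δ' := by
  ext α
  refine ⟨fun hα => h (.inl (.inl ⟨hα, α, hΔ.2.1 _ hα, rfl⟩)), fun hα => ?_⟩
  have hb : α.isBase := hΔ'.2.1 _ hα
  have hs := hb.isStatic
  by_contra hn
  have hd : diaK z α.neg ∈ Δ := by
    refine (hΔ.neg_mem_iff (φ := .K z α.neg.neg) hb).2 fun hK => hn (hΔ.K_mem_mono (α := α.neg.neg) hb hb ?_ hK)
    refine .taut ⟨hs, hs⟩ fun v => ?_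
    simp only [evalProp_imp, evalProp_neg]
    tauto
  refine (hΔ'.neg_mem_iff (φ := .K z α.neg.neg) hb).1
    (h (.inl (.inr ⟨hd, α.neg, hb, rfl⟩))) (hΔ'.K_mem_mono (β := α.neg.neg) hb hb ?_ hα)
  refine .taut ⟨hs, hs⟩ fun v => ?_
  simp only [evalProp_imp, evalProp_neg]
  tauto

theorem KzEqSet_mem_of_seed_subset (hΔ : MCS k Δ) {Δ' : Set (Form Pred Cons)}
    (hΔ' : MCS k Δ') {z : Var} {d : Cons} {T : Finset Cons} (h : seed z Δ d β ⊆ Δ')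
    (hT : KzEqSet z z.other T ∈ Δ) : KzEqSet z z.other T ∈ Δ' := by
  rw [KzEqSet, hΔ.bigAnd_mem_iff] at hT
  rw [KzEqSet, hΔ'.bigAnd_mem_iff]
  intro φ hφ
  have hm := hT φ hφ
  rcases List.mem_append.1 hφ with h' | h' <;> obtain ⟨c, -, rfl⟩ := List.mem_map.1 h'
  · exact h (.inl (.inr ⟨hm, .eq (.var z.other) (.const c), trivial, rfl⟩))
  · exact h (.inl (.inl ⟨hm, .neg (.eq (.var z.other) (.const c)), trivial, rfl⟩))

/-- If `z` is at `d` in `Δ`, does not know `α`, and considers the positions in `T` possible for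
the opponent, then `α` fails at `Δ₀` or at some situation with the same knowledge of `z` where
the opponent is elsewhere and knows that `z` is at `d`. -/
theorem exists_not_mem_of_K_not_mem (hΔ : MCS k Δ) (hΔ₀ : MCS k Δ₀) (hc : consEq Δ Δ₀)
    {z : Var} {T : Finset Cons} {d e : Cons} (hT : KzEqSet z z.other T ∈ Δ)
    (hT₀ : KzEqSet z z.other T ∈ Δ₀) (hd : .eq (.var z) (.const d) ∈ Δ)
    (hd₀ : .eq (.var z) (.const d) ∈ Δ₀) (he : .eq (.var z.other) (.const e) ∈ Δ₀)
    (hα : α.isBase) (hK : .K z α ∉ Δ) :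
    ∃ Δ', (Δ' = Δ₀ ∨ (MCS k Δ' ∧ consEq Δ' Δ₀ ∧ KzEqSet z z.other T ∈ Δ' ∧
      .K z.other (.eq (.var z) (.const d)) ∈ Δ' ∧
      ∃ c ∈ T, .eq (.var z.other) (.const c) ∈ Δ' ∧ .neg (.eq (.const c) (.const e)) ∈ Δ')) ∧
      Kset z Δ = Kset z Δ' ∧ α ∉ Δ' := by
  have hset := hΔ.Kset_eq hΔ₀ hc hT hT₀ hd hd₀
  have hK₀ : .K z α ∉ Δ₀ := fun h => hK ((Set.ext_iff.1 hset α).2 h)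
  obtain ⟨c, hcT, hcα⟩ : ∃ c ∈ T, α.substC c z.other ∉ Δ₀ := by
    rw [hΔ₀.K_mem_iff hT₀ hα] at hK₀
    push Not at hK₀
    exact hK₀
  by_cases hce : .eq (.const c) (.const e) ∈ Δ₀
  · refine ⟨Δ₀, .inl rfl, hset, fun h => hcα ?_⟩
    refine (hΔ₀.substC_mem_iff hα (hΔ₀.mem_of_prov_imp (.eqTrans _ (.const e) _)
      (hΔ₀.and_mem_iff.2 ⟨he, ?_⟩) trivial)).2 h
    exact hΔ₀.mem_of_prov_imp (.eqSymm _ _) hce trivial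
  have hβ : ((Form.eq (.var z.other) (.const c)).and α.neg).isBase := ⟨trivial, hα⟩
  have hcons := hΔ₀.seed_consistentS (z := z) (d := d) hβ fun h => by
    have h' := (hΔ₀.K_mem_iff (α := (Form.eq (.var z) (.const d)).imp
      (.neg ((Form.eq (.var z.other) (.const c)).and α.neg))) hT₀ ⟨trivial, hβ⟩).1 h c hcT
    have hzz : Term.substC c z.other (.var z) = .var z := by
      cases z <;> simp [Term.substC, Var.other]
    have h'' := hΔ₀.mem_of_imp
      (φ := .eq (Term.substC c z.other (.var z)) (.const d)) h' (by rwa [hzz])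
    refine (hΔ₀.neg_mem_iff (hβ.substC c z.other).isStatic).1 h'' (hΔ₀.and_mem_iff.2 ⟨?_, ?_⟩)
    · simpa [Form.substC, Term.substC] using hΔ₀.mem_of_prov (.eqRefl (.const c)) trivial
    · exact (hΔ₀.neg_mem_iff (hα.substC c _).isStatic).2 hcα
  obtain ⟨Δ', hsub, hΔ'⟩ := hcons.exists_mcs (seed_isStatic hβ)
  have hset' := hΔ₀.Kset_eq_of_seed_subset hΔ' hsub
  have hce' := hΔ'.consEq_of_Kset_eq hΔ₀ hset'.symm
  have hmem := hΔ'.and_mem_iff.1 (hsub (.inr (.inr rfl)))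
  refine ⟨Δ', .inr ⟨hΔ', hce', hΔ₀.KzEqSet_mem_of_seed_subset hΔ' hsub hT₀,
    hsub (.inr (.inl rfl)), c, hcT, hmem.1, ?_⟩, hset.trans hset',
    (hΔ'.neg_mem_iff hα.isStatic).1 hmem.2⟩
  refine (hce' (.neg (.eq (.const c) (.const e))) trivial ?_).2
    ((hΔ₀.neg_mem_iff (φ := .eq (.const c) (.const e)) trivial).2 hce)
  simp [isConsOnly, termList]

end MCS

/-- **Existence Lemma.** If `K_z α ∉ Δ` for `Δ` in the canonical
model, then some `Δ'` in the canonical model is `∼_z`-related to `Δ` with `α ∉ Δ'`. -/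
theorem existence_lemma {Pred Cons : Type} [Fintype Cons] [DecidableEq Cons]
    [Nonempty Cons] (k : ℕ) (Δ₀ : Set (Form Pred Cons)) (Ty Tx : Finset Cons)
    (cx cy : Cons) (hM : MCS k Δ₀)
    (h₁ : KzEqSet Var.x Var.y Ty ∈ Δ₀) (h₂ : KzEqSet Var.y Var.x Tx ∈ Δ₀)
    (h₃ : Form.eq (Term.var .x) (Term.const cx) ∈ Δ₀)
    (h₄ : Form.eq (Term.var .y) (Term.const cy) ∈ Δ₀) :
    ∀ z : Var, ∀ Δ ∈ CanSit k Δ₀ Ty Tx cx cy, ∀ α : Form Pred Cons, α.isBase →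
      Form.K z α ∉ Δ →
      ∃ Δ' ∈ CanSit k Δ₀ Ty Tx cx cy, Kset z Δ = Kset z Δ' ∧ α ∉ Δ' := by
  rintro z Δ ((rfl | hΔ) | hΔ) α hα hK
  · cases z
    · obtain ⟨Δ', h, h'⟩ := hM.exists_not_mem_of_K_not_mem hM (fun _ _ _ => Iff.rfl)
        (z := .x) h₁ h₁ h₃ h₃ h₄ hα hK
      exact ⟨Δ', .inl h, h'⟩
    · obtain ⟨Δ', h, h'⟩ := hM.exists_not_mem_of_K_not_mem hM (fun _ _ _ => Iff.rfl)
        (z := .y) h₂ h₂ h₄ h₄ h₃ hα hK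
      exact ⟨Δ', h.elim (fun h => .inl (.inl h)) .inr, h'⟩
  · obtain ⟨hΔM, hc, hT, hKd, -⟩ := id hΔ
    cases z
    · obtain ⟨Δ', h, h'⟩ := hΔM.exists_not_mem_of_K_not_mem hM hc (z := .x) hT h₁
        (hΔM.mem_of_prov_imp (.tAx _ trivial) hKd trivial) h₃ h₄ hα hK
      exact ⟨Δ', .inl h, h'⟩
    · exact ⟨Δ, .inl (.inr hΔ), rfl, fun h => hK (hΔM.K_mem_of_K_eq_mem (z := .y) hKd hα h)⟩
  · obtain ⟨hΔM, hc, hT, hKd, -⟩ := id hΔ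
    cases z
    · exact ⟨Δ, .inr hΔ, rfl, fun h => hK (hΔM.K_mem_of_K_eq_mem (z := .x) hKd hα h)⟩
    · obtain ⟨Δ', h, h'⟩ := hΔM.exists_not_mem_of_K_not_mem hM hc (z := .y) hT h₂
        (hΔM.mem_of_prov_imp (.tAx _ trivial) hKd trivial) h₄ h₃ hα hK
      exact ⟨Δ', h.elim (fun h => .inl (.inl h)) .inr, h'⟩
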